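/- Let Σp and Σq be d×d real symmetric positive-definite matrices. Then −d·log 2 + log det(Σq⁻¹Σp + I) + (1/2)·log det(Σq⁻¹Σp) − trace(Σq⁻¹Σp) + d ≤ 0. -/

import Mathlib

open Matrix Real

/-- `log det A ≤ tr A - n` for a positive definite matrix `A`. -/
lemma Matrix.PosDef.log_det_le_trace_sub_card {n : Type*} [Fintype n] [DecidableEq n]
    {A : Matrix n n ℝ} (hA : A.PosDef) :
    Real.log A.det ≤ A.trace - Fintype.card n := by
  rw [hA.1.det_eq_prod_eigenvalues, hA.1.trace_eq_sum_eigenvalues]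
  simp only [RCLike.ofReal_real_eq_id, id_eq]
  rw [Real.log_prod fun i _ => (hA.eigenvalues_pos i).ne']
  calc ∑ i, Real.log (hA.1.eigenvalues i) ≤ ∑ i, (hA.1.eigenvalues i - 1) :=
        Finset.sum_le_sum fun i _ => Real.log_le_sub_one_of_pos (hA.eigenvalues_pos i)
    _ = _ := by simp

open scoped MatrixOrder ComplexOrder in
/-- A positive definite matrix is of the form `Bᴴ * B` with `B` invertible. -/
lemma Matrix.PosDef.exists_isUnit_eq_conjTranspose_mul_self {n : Type*} [Fintype n]
    [DecidableEq n] {A : Matrix n n ℝ} (hA : A.PosDef) :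
    ∃ B : Matrix n n ℝ, IsUnit B ∧ A = Bᴴ * B := by
  obtain ⟨B, hB⟩ := CStarAlgebra.nonneg_iff_eq_star_mul_self.mp hA.posSemidef.nonneg
  refine ⟨B, ?_, hB⟩
  have h := hA.isUnit
  rw [hB] at h
  exact isUnit_of_mul_isUnit_right h

/-- The covariance part of the difference `2(D_CS − D_KL)` between Gaussians is
nonpositive. -/
theorem covariance_term_nonpos (d : ℕ)
    (Sp Sq : Matrix (Fin d) (Fin d) ℝ)
    (hp : Sp.PosDef) (hq : Sq.PosDef) :
    -(d : ℝ) * Real.log 2 + Real.log ((Sq⁻¹ * Sp + 1).det)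
        + (1 / 2) * Real.log ((Sq⁻¹ * Sp).det)
        - (Sq⁻¹ * Sp).trace + d ≤ 0 := by
  obtain ⟨B, hB, hBq⟩ := hq.inv.exists_isUnit_eq_conjTranspose_mul_self
  have hN : (B * Sp * Bᴴ).PosDef := (Matrix.IsUnit.posDef_star_right_conjugate_iff hB).mpr hp
  have hdet : (Sq⁻¹ * Sp).det = (B * Sp * Bᴴ).det := by
    rw [hBq, mul_assoc, det_mul_comm]
  have htr : (Sq⁻¹ * Sp).trace = (B * Sp * Bᴴ).trace := by
    rw [hBq, mul_assoc, trace_mul_comm]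
  have hdet1 : (Sq⁻¹ * Sp + 1).det = (B * Sp * Bᴴ + 1).det := by
    rw [hBq, mul_assoc, add_comm, det_one_add_mul_comm, add_comm]
  have hN1 : (B * Sp * Bᴴ + 1).PosDef := hN.add PosDef.one
  have h1 := hN.log_det_le_trace_sub_card
  have h2 := (hN1.smul (show (0 : ℝ) < 1 / 2 by norm_num)).log_det_le_trace_sub_card
  rw [det_smul, Real.log_mul (by positivity) hN1.det_pos.ne', Real.log_pow, one_div,
    Real.log_inv, trace_smul, trace_add, trace_one] at h2
  simp only [Fintype.card_fin, smul_eq_mul] at h1 h2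
  rw [hdet, htr, hdet1]
  linarith
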